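/- Let α = (φ,σ) be a minimal action of ℤ⋊ℤ₂ on a Cantor set X which is not free. Then: H_0(ℤ⋊ℤ₂, C(X,ℤ)) ≅ (1+σ_*)H_0(ℤ, C(X,ℤ)); H_{2n−1}(ℤ⋊ℤ₂, C(X,ℤ)) ≅ C(Fix_σ ⊔ Fix_{φ∘σ}, ℤ/2ℤ) for every n ≥ 1, where Fix_σ and Fix_{φ∘σ} are the (disjoint) fixed-point sets of σ and φ∘σ; and H_{2n}(ℤ⋊ℤ₂, C(X,ℤ)) = 0 for every n ≥ 1. -/

import Mathlib

section GroupHomologyDef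

variable (G M : Type*) [Group G] [AddCommGroup M] [DistribMulAction G M]

/-- The differential on inhomogeneous chains computing the homology of the group `G` with
coefficients in the `G`-module `M` (for the left action of `G` on `M`; a right module is
regarded as a left module by acting by inverses, which does not change homology). -/
noncomputable def inhomogeneousChainsD (n : ℕ) :
    ((Fin (n + 1) → G) →₀ M) →+ ((Fin n → G) →₀ M) :=
  Finsupp.liftAddHom fun g =>
    { toFun := fun m =>
        Finsupp.single (fun i => g i.succ) ((g 0)⁻¹ • m) +
          ∑ j : Fin (n + 1),
            (-1 : ℤ) ^ ((j : ℕ) + 1) • Finsupp.single (Fin.contractNth j (· * ·) g) m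
      map_zero' := by simp
      map_add' := fun a b => by
        simp only [smul_add, Finsupp.single_add, Finset.sum_add_distrib]
        abel }

/-- The subgroup of `n`-cycles of the complex of inhomogeneous chains. -/
noncomputable def homologyCycles : ∀ n : ℕ, AddSubgroup ((Fin n → G) →₀ M)
  | 0 => ⊤
  | (m + 1) => (inhomogeneousChainsD G M m).ker

/-- The `n`-th homology group `Hₙ(G, M)` of the group `G` with coefficients in the
`G`-module `M`: the quotient of the `n`-cycles by the `n`-boundaries of the complex of
inhomogeneous chains. -/
noncomputable def GroupHomology (n : ℕ) : Type _ :=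
  homologyCycles G M n ⧸
    ((inhomogeneousChainsD G M n).range.addSubgroupOf (homologyCycles G M n))

noncomputable instance (n : ℕ) : AddCommGroup (GroupHomology G M n) :=
  QuotientAddGroup.Quotient.addCommGroup _

end GroupHomologyDef

variable {X : Type*} [TopologicalSpace X]

/-- The subgroup `B = {h - h ∘ ψ : h ∈ C(Z, ℤ)}` of `C(Z, ℤ)`. -/
def coboundariesSubgroup {Z : Type*} [TopologicalSpace Z] (ψ : C(Z, Z)) :
    AddSubgroup C(Z, ℤ) :=
  (AddMonoidHom.mk' (fun h : C(Z, ℤ) => h - h.comp ψ)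
    (fun f g => by ext x; simp; ring)).range

/-- The subgroup `(1 + σ_*) H₀(ℤ, C(X, ℤ)) = {[f + f ∘ σ] : f ∈ C(X, ℤ)}` of the
coinvariants `H₀(ℤ, C(X, ℤ)) = C(X, ℤ) ⧸ {h - h ∘ φ}`. -/
def onePlusSigmaStar (φ σ : X ≃ₜ X) :
    AddSubgroup (C(X, ℤ) ⧸ coboundariesSubgroup (φ : C(X, X))) :=
  AddSubgroup.map (QuotientAddGroup.mk' (coboundariesSubgroup (φ : C(X, X))))
    (AddMonoidHom.mk' (fun f : C(X, ℤ) => f + f.comp (σ : C(X, X)))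
      (fun f g => by ext x; simp; ring)).range


section GroupRing

open MonoidAlgebra

variable {k G : Type*} [CommRing k] [Group G]

theorem MonoidAlgebra.coeff_mul_single_inv (x : MonoidAlgebra k G) (g h : G) :
    (x * single h 1).coeff g = x.coeff (g * h⁻¹) := by
  simp

/-- A choice of one element in each pair `{g, g * a}`, for an involution `a`. -/
theorem exists_transversal_of_involution {a : G} (ha : a * a = 1) (ha1 : a ≠ 1) :
    ∃ T : Set G, ∀ g, g * a ∈ T ↔ g ∉ T := by
  classical
  let _ : LinearOrder G := linearOrderOfSTO WellOrderingRel
  refine ⟨{g | g < g * a}, fun g => ?_⟩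
  have h : g * a * a = g := by rw [mul_assoc, ha, mul_one]
  have hne : g * a ≠ g := by simpa using ha1
  simp only [Set.mem_ofPred_eq, h, not_lt]
  exact ⟨le_of_lt, fun hle => lt_of_le_of_ne hle hne⟩

theorem MonoidAlgebra.exists_eq_mul_involution_add_smul_one {a : G} (ha : a * a = 1)
    (ha1 : a ≠ 1) {ε : k} (hε : ε * ε = 1) {x : MonoidAlgebra k G}
    (hx : x * single a 1 = ε • x) :
    ∃ y : MonoidAlgebra k G, x = y * (single a 1 + single 1 ε) := by
  classical
  obtain ⟨T, hT⟩ := exists_transversal_of_involution ha ha1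
  have hinv : a⁻¹ = a := inv_eq_of_mul_eq_one_left ha
  have hxa : ∀ g, x.coeff (g * a) = ε * x.coeff g := fun g => by
    have := congrArg (fun z => z.coeff g) hx
    simpa [MonoidAlgebra.coeff_mul_single_inv, hinv] using this
  refine ⟨ε • .ofCoeff (x.coeff.filter (· ∈ T)), ?_⟩
  have h1 : (single (1 : G) ε : MonoidAlgebra k G) = ε • 1 := by
    simp [MonoidAlgebra.one_def]
  rw [h1, mul_add, mul_smul_comm, mul_one, smul_smul, hε, one_smul]
  ext g
  simp only [coeff_add, Finsupp.add_apply, smul_mul_assoc, coeff_smul, Finsupp.smul_apply,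
    MonoidAlgebra.coeff_mul_single_inv, hinv, Finsupp.filter_apply, hT, hxa,
    smul_eq_mul]
  by_cases hg : g ∈ T
  · simp [hg]
  · simp [hg, ← mul_assoc, hε]

theorem MonoidAlgebra.mul_involution_sub_one_eq_zero {a b : G} (ha : a * a = 1) (hb : b * b = 1)
    (hab : ¬ IsOfFinOrder (a * b)) {x y : MonoidAlgebra k G}
    (h : x * (single a 1 - 1) + y * (single b 1 - 1) = 0) :
    x * (single a 1 - 1) = 0 := by
  have key : ∀ {c : G}, c * c = 1 → ∀ z : MonoidAlgebra k G,
      z * (single c 1 - 1) * single c 1 = - (z * (single c 1 - 1)) := fun {c} hc z => by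
    rw [mul_assoc, sub_mul, single_mul_single, hc, one_mul, one_mul, ← one_def, ← mul_neg, neg_sub]
  have hu := key ha x
  have hv := key hb y
  set u := x * (single a 1 - 1) with hu_def
  rw [← neg_eq_iff_add_eq_zero] at h
  rw [← h, neg_mul, neg_inj] at hv
  have hab' : u * single (a * b) 1 = u := by
    rw [← mul_one (1 : k), ← single_mul_single, ← mul_assoc, hu, neg_mul, hv, neg_neg]
  have hpow : ∀ n : ℕ, u * single ((a * b) ^ n) 1 = u := fun n => by
    induction n with
    | zero => rw [pow_zero, ← one_def, mul_one]
    | succ n ih => rw [pow_succ, ← mul_one (1 : k), ← single_mul_single, ← mul_assoc, ih, hab']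
  ext g
  by_contra hg
  have hinj : Function.Injective fun n : ℕ => g * ((a * b) ^ n)⁻¹ := fun m n hmn =>
    injective_pow_iff_not_isOfFinOrder.2 hab (by simpa using hmn)
  refine Set.infinite_of_injective_forall_mem hinj (s := u.coeff.support) (fun n => ?_)
    (Finset.finite_toSet _)
  have := congrArg (fun z => z.coeff g) (hpow n)
  simp only [MonoidAlgebra.coeff_mul_single_inv] at this
  simpa [this] using hg

theorem MonoidAlgebra.exists_eq_sum_mul_sub_one {I : Type*} [Fintype I] (s : I → G)
    (hs : ∀ i, s i * s i = 1) (hgen : Subgroup.closure (Set.range s) = ⊤)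
    (x : MonoidAlgebra k G) (hx : (x.coeff.sum fun _ r => r) = 0) :
    ∃ y : I → MonoidAlgebra k G, x = ∑ i, y i * (single (s i) 1 - 1) := by
  classical
  let L : Submodule (MonoidAlgebra k G) (MonoidAlgebra k G) :=
    Submodule.span _ (Set.range fun i => (single (s i) 1 - 1 : MonoidAlgebra k G))
  have hL : ∀ g : G, (single g 1 - 1 : MonoidAlgebra k G) ∈ L := fun g => by
    have hg : g ∈ Subgroup.closure (Set.range s) := hgen ▸ Subgroup.mem_top g
    have step : ∀ (g : G) (i : I), (single g 1 - 1 : MonoidAlgebra k G) ∈ L →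
        (single (g * s i) 1 - 1 : MonoidAlgebra k G) ∈ L := fun g i ih => by
      have : (single (g * s i) 1 - 1 : MonoidAlgebra k G) =
          (single g 1 : MonoidAlgebra k G) • (single (s i) 1 - 1) + (single g 1 - 1) := by
        rw [smul_eq_mul, mul_sub, single_mul_single, mul_one, mul_one]; abel
      rw [this]
      exact L.add_mem (L.smul_mem _ (Submodule.subset_span ⟨i, rfl⟩)) ih
    induction hg using Subgroup.closure_induction_right with
    | one => rw [← one_def, sub_self]; exact L.zero_mem
    | mul_right g hg t ht ih => obtain ⟨i, rfl⟩ := ht; exact step g i ih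
    | mul_inv_cancel g hg t ht ih =>
      obtain ⟨i, rfl⟩ := ht
      rw [inv_eq_of_mul_eq_one_left (hs i)]
      exact step g i ih
  have hxL : x ∈ L := by
    have : x = x.coeff.sum fun g r => r • (single g 1 - 1 : MonoidAlgebra k G) := by
      have h2 : (x.coeff.sum fun _ r => r • (1 : MonoidAlgebra k G)) = 0 := by
        rw [Finsupp.sum, ← Finset.sum_smul]
        change (x.coeff.sum fun _ r => r) • _ = _
        rw [hx, zero_smul]
      simp only [smul_sub]
      rw [Finsupp.sum_sub, h2, sub_zero]
      simp
    rw [this]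
    exact Submodule.sum_mem _ fun g _ => Submodule.smul_of_tower_mem L _ (hL g)
  obtain ⟨c, hc⟩ := (Submodule.mem_span_range_iff_exists_fun _).1 hxL
  exact ⟨c, by simpa using hc.symm⟩

end GroupRing

section Resolution

open CategoryTheory Rep

universe u

variable (k : Type u) {G : Type u} [CommRing k] [Group G] {I : Type u} (s : I → G)

/-- Basis of the `n`-th term of `involutionComplex`. -/
@[reducible] def involutionIndex (I : Type u) : ℕ → Type u
  | 0 => PUnit
  | _ + 1 => I

instance [DecidableEq I] (n : ℕ) : DecidableEq (involutionIndex I n) := by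
  cases n <;> infer_instance

theorem Rep.freeLift_single_apply {J : Type u} (f : I → J) (c : I → MonoidAlgebra k G)
    (x : I →₀ MonoidAlgebra k G) :
    (freeLift k G (A := free k G J) fun i => Finsupp.single (f i) (c i)).hom x =
      x.sum fun i r => Finsupp.single (f i) (r * c i) := by
  have : (freeLift k G (A := free k G J) fun i => Finsupp.single (f i) (c i)).hom.toLinearMap =
      Finsupp.lsum k fun i => Finsupp.lsingle (f i) ∘ₗ LinearMap.mulRight k (c i) := by
    refine Finsupp.lhom_ext' fun i => MonoidAlgebra.lhom_ext' fun g => LinearMap.ext_ring ?_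
    have h : ∀ y : MonoidAlgebra k G,
        Representation.leftRegular k G g y = MonoidAlgebra.single g 1 * y := fun y => by
      induction y using MonoidAlgebra.induction_linear with
      | zero => simp
      | add y z hy hz => rw [map_add, hy, hz, mul_add]
      | single h r => simp
    simp [-Finsupp.single_mul, h]
  exact LinearMap.congr_fun this x

/-- The differentials of `involutionComplex`. -/
noncomputable def involutionD : ∀ n : ℕ,
    (free k G (involutionIndex I (n + 1)) ⟶ free k G (involutionIndex I n))
  | 0 => freeLift k G _ fun i =>
      Finsupp.single PUnit.unit (MonoidAlgebra.single (s i) 1 + MonoidAlgebra.single 1 (-1))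
  | n + 1 => freeLift k G _ fun i =>
      Finsupp.single i (MonoidAlgebra.single (s i) 1 + MonoidAlgebra.single 1 ((-1) ^ n))

theorem involutionD_zero_apply (x : I →₀ MonoidAlgebra k G) :
    (involutionD k s 0).hom x = x.sum fun i r => Finsupp.single PUnit.unit
      (r * (MonoidAlgebra.single (s i) 1 + MonoidAlgebra.single 1 (-1))) :=
  Rep.freeLift_single_apply k (fun _ => PUnit.unit) _ x

theorem involutionD_succ_apply (n : ℕ) (x : I →₀ MonoidAlgebra k G) (i : I) :
    ((involutionD k s (n + 1)).hom x : I →₀ MonoidAlgebra k G) i =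
      x i * (MonoidAlgebra.single (s i) 1 + MonoidAlgebra.single 1 ((-1) ^ n)) := by
  classical
  refine (DFunLike.congr_fun (Rep.freeLift_single_apply k id _ x) i).trans ?_
  rw [Finsupp.sum_apply, Finsupp.sum_eq_single i]
  · simp
  · intro j _ hj
    simp [hj]
  · simp

variable {s}

theorem involutionD_comp (hs : ∀ i, s i * s i = 1) (n : ℕ) :
    involutionD k s (n + 1) ≫ involutionD k s n = 0 := by
  have hmul : ∀ (i : I) (ε : k), ε * ε = 1 →
      (MonoidAlgebra.single (s i) 1 + MonoidAlgebra.single 1 ε : MonoidAlgebra k G) *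
        (MonoidAlgebra.single (s i) 1 + MonoidAlgebra.single 1 (-ε)) = 0 := fun i ε hε => by
    simp only [add_mul, mul_add, MonoidAlgebra.single_mul_single, hs, mul_one, one_mul, mul_neg,
      hε, MonoidAlgebra.single_neg]
    abel
  refine Rep.hom_ext (DFunLike.ext _ _ fun x => ?_)
  cases n with
  | zero =>
    change (involutionD k s 0).hom ((involutionD k s 1).hom x) = 0
    rw [involutionD_zero_apply]
    refine Finset.sum_eq_zero fun i _ => ?_
    rw [involutionD_succ_apply]
    beta_reduce
    rw [mul_assoc, pow_zero, hmul i 1 (one_mul 1), mul_zero,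
      Finsupp.single_zero]
  | succ n =>
    refine Finsupp.ext fun i => ?_
    change ((involutionD k s (n + 1)).hom ((involutionD k s (n + 2)).hom x) :
      I →₀ MonoidAlgebra k G) i = 0
    rw [involutionD_succ_apply, involutionD_succ_apply, mul_assoc, pow_succ]
    have := hmul i ((-1) ^ n * -1) (by rw [← pow_succ, ← mul_pow]; simp)
    simp only [mul_neg, mul_one, neg_neg] at this ⊢
    rw [this, mul_zero]

/-- The complex of free representations attached to a family of involutions. It is a resolution
of `k` when `G` is the free product of the groups generated by these. -/
noncomputable def involutionComplex (hs : ∀ i, s i * s i = 1) : ChainComplex (Rep k G) ℕ :=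
  ChainComplex.of (fun n => free k G (involutionIndex I n)) (involutionD k s)
    (involutionD_comp k hs)

theorem involutionComplex_d (hs : ∀ i, s i * s i = 1) (n : ℕ) :
    (involutionComplex k hs).d (n + 1) n = involutionD k s n := by
  simp [involutionComplex]

end Resolution

section Homology

open CategoryTheory

universe u

/-- The homology of a complex of modules, computed through additive identifications of its terms
with other groups. -/
theorem ChainComplex.nonempty_homology_addEquiv {k : Type u} [Ring k]
    (C : ChainComplex (ModuleCat.{u} k) ℕ) {B : ℕ → Type*} [∀ n, AddCommGroup (B n)]
    (D : ∀ n, B (n + 1) →+ B n) (e : ∀ n, C.X n ≃+ B n)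
    (he : ∀ n x, e n (C.d (n + 1) n x) = D n (e (n + 1) x)) (n : ℕ) :
    Nonempty (C.homology (n + 1) ≃+
      (D n).ker ⧸ (D (n + 1)).range.addSubgroupOf (D n).ker) := by
  let S := C.sc' (n + 2) (n + 1) n
  let i : C.homology (n + 1) ≅ ModuleCat.of k
      (LinearMap.ker S.g.hom ⧸ LinearMap.range S.moduleCatToCycles) :=
    C.homologyIsoSc' (n + 2) (n + 1) n (by simp) (by simp) ≪≫ S.moduleCatHomologyIso
  have hker : ∀ x : C.X (n + 1), x ∈ LinearMap.ker S.g.hom ↔ e (n + 1) x ∈ (D n).ker := fun x => by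
    rw [AddMonoidHom.mem_ker, ← he, EmbeddingLike.map_eq_zero_iff]
    rfl
  let f : LinearMap.ker S.g.hom ≃+ (D n).ker :=
    { toFun x := ⟨e (n + 1) x.1, (hker _).1 x.2⟩
      invFun y := ⟨(e (n + 1)).symm y.1, (hker _).2 (by simp)⟩
      left_inv x := Subtype.ext ((e (n + 1)).symm_apply_apply x.1)
      right_inv y := by ext; simp
      map_add' x y := Subtype.ext (map_add (e (n + 1)) x.1 y.1) }
  refine ⟨i.toLinearEquiv.toAddEquiv.trans (QuotientAddGroup.congr
    (LinearMap.range S.moduleCatToCycles).toAddSubgroup _ f ?_)⟩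
  ext y
  simp only [AddSubgroup.mem_map, AddSubgroup.mem_addSubgroupOf, AddMonoidHom.mem_range]
  constructor
  · rintro ⟨_, ⟨x, rfl⟩, rfl⟩
    exact ⟨e (n + 2) x, (he (n + 1) x).symm⟩
  · rintro ⟨x, hx⟩
    refine ⟨S.moduleCatToCycles ((e (n + 2)).symm x), ⟨_, rfl⟩, Subtype.ext ?_⟩
    rw [← hx]
    exact (he (n + 1) _).trans (by simp)

end Homology

section Exactness

open CategoryTheory Rep

universe u

variable (k : Type u) {G : Type u} [CommRing k] [Group G] {I : Type u} {s : I → G}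

theorem involutionD_succ_exact (hs : ∀ i, s i * s i = 1) (hs1 : ∀ i, s i ≠ 1) [Fintype I] (n : ℕ)
    (x : I →₀ MonoidAlgebra k G)
    (hx : ∀ i, x i * (MonoidAlgebra.single (s i) 1 + MonoidAlgebra.single 1 (-(-1) ^ n)) = 0) :
    ∃ y : I →₀ MonoidAlgebra k G, (involutionD k s (n + 1)).hom y = x := by
  have : ∀ i, ∃ y : MonoidAlgebra k G,
      x i = y * (MonoidAlgebra.single (s i) 1 + MonoidAlgebra.single 1 ((-1) ^ n)) := fun i => by
    refine MonoidAlgebra.exists_eq_mul_involution_add_smul_one (hs i) (hs1 i)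
      (by rw [← mul_pow]; simp) ?_
    have h := hx i
    rw [MonoidAlgebra.single_neg, ← sub_eq_add_neg, mul_sub, sub_eq_zero] at h
    rw [h]
    ext g
    rw [MonoidAlgebra.coeff_mul_single_one]
    simp [mul_comm]
  choose y hy using this
  refine ⟨Finsupp.equivFunOnFinite.symm y, Finsupp.ext fun i => ?_⟩
  rw [involutionD_succ_apply, hy i]
  rfl

theorem involutionD_one_exact (hs : ∀ i, s i * s i = 1) (hs1 : ∀ i, s i ≠ 1) [Fintype I]
    (hindep : ∀ x : I → MonoidAlgebra k G,
      ∑ i, x i * (MonoidAlgebra.single (s i) 1 - 1) = 0 →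
        ∀ i, x i * (MonoidAlgebra.single (s i) 1 - 1) = 0)
    (x : I →₀ MonoidAlgebra k G) (hx : (involutionD k s 0).hom x = 0) :
    ∃ y : I →₀ MonoidAlgebra k G, (involutionD k s 1).hom y = x := by
  refine involutionD_succ_exact k hs hs1 0 x ?_
  have h1 : ∀ g : G, (MonoidAlgebra.single g 1 + MonoidAlgebra.single 1 (-1) :
      MonoidAlgebra k G) = MonoidAlgebra.single g 1 - 1 := fun g => by
    rw [MonoidAlgebra.single_neg, ← MonoidAlgebra.one_def, sub_eq_add_neg]
  simp only [pow_zero, h1]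
  refine hindep x ?_
  rw [involutionD_zero_apply] at hx
  have := DFunLike.congr_fun hx PUnit.unit
  rw [Finsupp.sum_apply, Finsupp.sum_fintype _ _ (by simp)] at this
  simp only [h1, Finsupp.single_eq_same] at this
  exact this

theorem involutionD_succ_succ_exact (hs : ∀ i, s i * s i = 1) (hs1 : ∀ i, s i ≠ 1) [Fintype I]
    (n : ℕ) (x : I →₀ MonoidAlgebra k G) (hx : (involutionD k s (n + 1)).hom x = 0) :
    ∃ y : I →₀ MonoidAlgebra k G, (involutionD k s (n + 2)).hom y = x := by
  refine involutionD_succ_exact k hs hs1 (n + 1) x fun i => ?_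
  have := DFunLike.congr_fun hx i
  simpa [pow_succ] using (involutionD_succ_apply k s n x i).symm.trans this

/-- The augmentation of `involutionComplex`. -/
noncomputable def involutionAug : free k G (involutionIndex I 0) ⟶ Rep.trivial k G k :=
  freeLift k G _ fun _ => (1 : k)

theorem involutionAug_apply (x : PUnit →₀ MonoidAlgebra k G) :
    (involutionAug (I := I) k (G := G)).hom x = ((x PUnit.unit).coeff.sum fun _ r => r) := by
  have : (involutionAug (I := I) k (G := G)).hom.toLinearMap =
      Finsupp.linearCombination k (fun _ : G => (1 : k)) ∘ₗ
        (MonoidAlgebra.coeffLinearEquiv k).toLinearMap ∘ₗ Finsupp.lapply PUnit.unit := by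
    refine Finsupp.lhom_ext' fun i => MonoidAlgebra.lhom_ext' fun g => LinearMap.ext_ring ?_
    simp [involutionAug]
  refine (LinearMap.congr_fun this x).trans ?_
  simp [Finsupp.linearCombination_apply]

theorem involutionAug_single_one (r : k) :
    (involutionAug (I := I) k (G := G)).hom (Finsupp.single PUnit.unit (.single 1 r)) = r := by
  rw [involutionAug_apply, Finsupp.single_eq_same, MonoidAlgebra.coeff_single,
    Finsupp.sum_single_index rfl]

theorem involutionD_comp_aug : involutionD k s 0 ≫ involutionAug k = 0 := by
  refine Rep.free_ext k G _ _ _ fun i => ?_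
  change (involutionAug k).hom ((involutionD k s 0).hom _) = 0
  rw [involutionD_zero_apply, involutionAug_apply, Finsupp.sum_single_index (by simp),
    Finsupp.single_eq_same, mul_add, MonoidAlgebra.single_mul_single,
    MonoidAlgebra.single_mul_single, MonoidAlgebra.coeff_add,
    Finsupp.sum_add_index' (by simp) (by simp), MonoidAlgebra.coeff_single,
    MonoidAlgebra.coeff_single, Finsupp.sum_single_index rfl, Finsupp.sum_single_index rfl]
  simp

theorem involutionAug_exact (hs : ∀ i, s i * s i = 1) [Fintype I]
    (hgen : Subgroup.closure (Set.range s) = ⊤) (x : PUnit →₀ MonoidAlgebra k G)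
    (hx : (involutionAug (I := I) k (G := G)).hom x = 0) :
    ∃ y : I →₀ MonoidAlgebra k G, (involutionD k s 0).hom y = x := by
  rw [involutionAug_apply] at hx
  obtain ⟨y, hy⟩ := MonoidAlgebra.exists_eq_sum_mul_sub_one s hs hgen _ hx
  refine ⟨Finsupp.equivFunOnFinite.symm y, Finsupp.ext fun i => ?_⟩
  rw [involutionD_zero_apply, Finsupp.sum_apply, Finsupp.sum_fintype _ _ (by simp)]
  simp [hy, sub_eq_add_neg, MonoidAlgebra.one_def]

/-- The augmentation of `involutionComplex`, as a map of complexes. -/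
noncomputable def involutionπ (hs : ∀ i, s i * s i = 1) :
    involutionComplex k hs ⟶ (ChainComplex.single₀ (Rep k G)).obj (Rep.trivial k G k) :=
  ((involutionComplex k hs).toSingle₀Equiv _).symm
    ⟨involutionAug k, by rw [involutionComplex_d]; exact involutionD_comp_aug k⟩

theorem involutionπ_quasiIso (hs : ∀ i, s i * s i = 1) (hs1 : ∀ i, s i ≠ 1) [Fintype I]
    (hgen : Subgroup.closure (Set.range s) = ⊤)
    (hindep : ∀ x : I → MonoidAlgebra k G,
      ∑ i, x i * (MonoidAlgebra.single (s i) 1 - 1) = 0 →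
        ∀ i, x i * (MonoidAlgebra.single (s i) 1 - 1) = 0) :
    QuasiIso (involutionπ k hs) where
  quasiIsoAt m := by
    cases m with
    | zero =>
      rw [ChainComplex.quasiIsoAt₀_iff, ShortComplex.quasiIso_iff_of_zeros' _ rfl rfl rfl]
      constructor
      · apply (forget₂ _ (ModuleCat k)).reflects_exact_of_faithful
        rw [ShortComplex.moduleCat_exact_iff]
        intro x hx
        obtain ⟨y, hy⟩ := involutionAug_exact k hs hgen x hx
        refine ⟨y, ?_⟩
        change ((involutionComplex k hs).d 1 0).hom y = x
        rw [involutionComplex_d]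
        exact hy
      · rw [Rep.epi_iff_surjective]
        intro x
        refine ⟨Finsupp.single PUnit.unit (.single 1 x), ?_⟩
        change (involutionAug (I := I) k (G := G)).hom _ = x
        exact involutionAug_single_one k x
    | succ m =>
      rw [quasiIsoAt_iff_exactAt' (hL := ChainComplex.exactAt_succ_single_obj ..),
          HomologicalComplex.exactAt_iff' _ (m + 2) (m + 1) m (by simp) (by simp)]
      apply (forget₂ _ (ModuleCat k)).reflects_exact_of_faithful
      rw [ShortComplex.moduleCat_exact_iff]
      intro x hx
      change ((involutionComplex k hs).d (m + 1) m).hom x = 0 at hx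
      rw [involutionComplex_d] at hx
      suffices h : ∃ y, (involutionD k s (m + 1)).hom y = x by
        obtain ⟨y, hy⟩ := h
        refine ⟨y, ?_⟩
        change ((involutionComplex k hs).d (m + 2) (m + 1)).hom y = x
        rw [involutionComplex_d]
        exact hy
      cases m with
      | zero => exact involutionD_one_exact k hs hs1 hindep x hx
      | succ m => exact involutionD_succ_succ_exact k hs hs1 m x hx

/-- The free resolution of `k` attached to a family of involutions generating `G` freely. -/
noncomputable def involutionResolution (hs : ∀ i, s i * s i = 1) (hs1 : ∀ i, s i ≠ 1) [Fintype I]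
    (hgen : Subgroup.closure (Set.range s) = ⊤)
    (hindep : ∀ x : I → MonoidAlgebra k G,
      ∑ i, x i * (MonoidAlgebra.single (s i) 1 - 1) = 0 →
        ∀ i, x i * (MonoidAlgebra.single (s i) 1 - 1) = 0) :
    ProjectiveResolution (Rep.trivial k G k) where
  complex := involutionComplex k hs
  projective n := Rep.free_projective.{u, u} (k := k) (G := G) (α := involutionIndex I n)
  π := involutionπ k hs
  quasiIso := involutionπ_quasiIso k hs hs1 hgen hindep

end Exactness

section Coefficients

open CategoryTheory Rep MonoidalCategory TensorProduct Finsupp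

universe u

variable {k G : Type u} [CommRing k] [Group G] {I : Type u} (s : I → G) (A : Rep.{u} k G)

/-- The differentials of `A ⊗ involutionComplex`, after passing to coinvariants. -/
noncomputable def involutionCoeffD :
    ∀ n : ℕ, (involutionIndex I (n + 1) →₀ A) →ₗ[k] (involutionIndex I n →₀ A)
  | 0 => lsum k fun i => lsingle PUnit.unit ∘ₗ (A.ρ (s i)⁻¹ - LinearMap.id)
  | n + 1 => lsum k fun i => lsingle i ∘ₗ (A.ρ (s i)⁻¹ + (-1 : k) ^ n • LinearMap.id)

theorem involutionCoeffD_zero_apply [Fintype I] (x : I →₀ A) :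
    involutionCoeffD s A 0 x = single PUnit.unit (∑ i, (A.ρ (s i)⁻¹ (x i) - x i)) := by
  change (lsum k fun i => lsingle PUnit.unit ∘ₗ (A.ρ (s i)⁻¹ - LinearMap.id)) x = _
  rw [lsum_apply, Finsupp.sum_fintype _ _ (by simp), single_finsetSum]
  rfl

theorem involutionCoeffD_succ_apply (n : ℕ) (x : I →₀ A) (i : I) :
    (involutionCoeffD s A (n + 1) x : I →₀ A) i = A.ρ (s i)⁻¹ (x i) + (-1 : ℤ) ^ n • x i := by
  classical
  change ((lsum k fun i => lsingle i ∘ₗ (A.ρ (s i)⁻¹ + (-1 : k) ^ n • LinearMap.id)) x :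
    I →₀ A) i = _
  rw [lsum_apply, Finsupp.sum_apply, Finsupp.sum_eq_single i]
  · rw [← Int.cast_smul_eq_zsmul k]
    simp
  · intro j _ hj
    simp [hj]
  · simp

theorem involutionD_single (n : ℕ) (i : I) :
    (involutionD k s n).hom (single i (.single 1 1)) = match n with
      | 0 => single PUnit.unit (.single (s i) 1 + .single 1 (-1))
      | n + 1 => single i (.single (s i) 1 + .single 1 ((-1) ^ n)) := by
  cases n with
  | zero =>
    refine (involutionD_zero_apply k s _).trans ?_
    rw [sum_single_index (by simp), ← MonoidAlgebra.one_def, one_mul]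
  | succ n =>
    refine (Rep.freeLift_single_apply k id _ _).trans ?_
    rw [sum_single_index (by simp), ← MonoidAlgebra.one_def, one_mul]
    rfl

theorem coinvariantsTensorFreeLEquiv_involutionD [DecidableEq I] (n : ℕ)
    (x : Representation.Coinvariants (A ⊗ free.{u, u, u} k G (involutionIndex I (n + 1))).ρ) :
    coinvariantsTensorFreeLEquiv A (involutionIndex I n)
      ((((coinvariantsTensor k G).obj A).map (involutionD k s n)).hom x) =
    involutionCoeffD s A n (coinvariantsTensorFreeLEquiv A (involutionIndex I (n + 1)) x) := by
  obtain ⟨x, rfl⟩ := (coinvariantsTensorFreeLEquiv A (involutionIndex I (n + 1))).symm.surjective x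
  rw [LinearEquiv.apply_symm_apply]
  induction x using Finsupp.induction_linear with
  | zero => simp
  | add x y hx hy => simp only [map_add, hx, hy]
  | single i a =>
    rw [coinvariantsTensorFreeLEquiv_symm_apply, finsuppToCoinvariantsTensorFree_single]
    change coinvariantsTensorFreeToFinsupp A (involutionIndex I n) (Representation.Coinvariants.mk _
      (a ⊗ₜ[k] (involutionD k s n).hom (single i (.single 1 1)))) = _
    rw [involutionD_single]
    cases n with
    | zero =>
      dsimp only
      rw [single_add, TensorProduct.tmul_add, map_add, map_add]
      refine (congrArg₂ (· + ·) (coinvariantsTensorFreeToFinsupp_mk_tmul_single A _ _ _ _)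
        (coinvariantsTensorFreeToFinsupp_mk_tmul_single A _ _ _ _)).trans ?_
      simp [involutionCoeffD, sub_eq_add_neg]
    | succ n =>
      dsimp only
      rw [single_add, TensorProduct.tmul_add, map_add, map_add]
      refine (congrArg₂ (· + ·) (coinvariantsTensorFreeToFinsupp_mk_tmul_single A _ _ _ _)
        (coinvariantsTensorFreeToFinsupp_mk_tmul_single A _ _ _ _)).trans ?_
      simp [involutionCoeffD]

variable {s}

theorem nonempty_groupHomology_addEquiv_involution [DecidableEq G] [DecidableEq I] [Fintype I]
    (hs : ∀ i, s i * s i = 1) (hs1 : ∀ i, s i ≠ 1)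
    (hgen : Subgroup.closure (Set.range s) = ⊤)
    (hindep : ∀ x : I → MonoidAlgebra k G,
      ∑ i, x i * (MonoidAlgebra.single (s i) 1 - 1) = 0 →
        ∀ i, x i * (MonoidAlgebra.single (s i) 1 - 1) = 0) (n : ℕ) :
    Nonempty (groupHomology A (n + 1) ≃+ (involutionCoeffD s A n).toAddMonoidHom.ker ⧸
      (involutionCoeffD s A (n + 1)).toAddMonoidHom.range.addSubgroupOf
        (involutionCoeffD s A n).toAddMonoidHom.ker) := by
  let P := involutionResolution k hs hs1 hgen hindep
  let e : groupHomology A (n + 1) ≃+ (P.complex.coinvariantsTensorObj A).homology (n + 1) :=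
    (groupHomologyIso A (n + 1) P).toLinearEquiv.toAddEquiv
  obtain ⟨f⟩ := ChainComplex.nonempty_homology_addEquiv (P.complex.coinvariantsTensorObj A)
    (fun n => (involutionCoeffD s A n).toAddMonoidHom)
    (fun n => (coinvariantsTensorFreeLEquiv A (involutionIndex I n)).toAddEquiv)
    (fun n x => by
      change coinvariantsTensorFreeLEquiv A (involutionIndex I n)
        ((((coinvariantsTensor k G).obj A).map ((involutionComplex k hs).d (n + 1) n)).hom x) = _
      rw [involutionComplex_d]
      exact coinvariantsTensorFreeLEquiv_involutionD s A n x) n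
  exact ⟨e.trans f⟩

end Coefficients

section Universes

open CategoryTheory Finsupp

universe u

theorem groupHomology.inhomogeneousChains.d_single_eq_zsmul {k G : Type u} [CommRing k] [Group G]
    (A : Rep.{u} k G) (n : ℕ) (g : Fin (n + 1) → G) (a : A) :
    (groupHomology.inhomogeneousChains.d A n).hom (single g a) =
      single (fun i => g i.succ) (A.ρ (g 0)⁻¹ a) +
      ∑ j : Fin (n + 1), (-1 : ℤ) ^ ((j : ℕ) + 1) • single (Fin.contractNth j (· * ·) g) a := by
  refine (groupHomology.inhomogeneousChains.d_single n g a).trans ?_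
  refine congrArg _ (Finset.sum_congr rfl fun j _ => ?_)
  rw [← Int.cast_smul_eq_zsmul k]
  simp

/-- Group homology in the sense of Mathlib agrees with `GroupHomology`, in positive degrees. -/
theorem nonempty_groupHomology_addEquiv {k G' : Type u} [CommRing k] [Group G']
    (A : Rep.{u} k G') {G : Type*} {M : Type u} [Group G] [AddCommGroup M] [DistribMulAction G M]
    (e : G' ≃* G) (f : A ≃+ M) (hf : ∀ g a, f (A.ρ g a) = e g • f a) (n : ℕ) :
    Nonempty (groupHomology A (n + 1) ≃+ GroupHomology G M (n + 1)) := by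
  obtain ⟨F, hF⟩ : ∃ F : ∀ n : ℕ, ((Fin n → G') →₀ A) ≃+ ((Fin n → G) →₀ M),
      ∀ n g a, F n (single g a) = single (fun i => e (g i)) (f a) :=
    ⟨fun n => (Finsupp.domCongr (Equiv.arrowCongr (Equiv.refl (Fin n)) e.toEquiv)).trans
      (Finsupp.mapRange.addEquiv f), fun n g a => by
        simp
        rfl⟩
  have h (n : ℕ) : (F n : _ →+ _).comp
      (groupHomology.inhomogeneousChains.d A n).hom.toAddMonoidHom =
      (inhomogeneousChainsD G M n).comp (F (n + 1) : _ →+ _) := by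
    refine Finsupp.addHom_ext fun g a => ?_
    change F n ((groupHomology.inhomogeneousChains.d A n).hom (single g a)) =
      inhomogeneousChainsD G M n (F (n + 1) (single g a))
    rw [hF, groupHomology.inhomogeneousChains.d_single_eq_zsmul]
    simp only [inhomogeneousChainsD, liftAddHom_apply_single, AddMonoidHom.coe_mk, ZeroHom.coe_mk,
      map_add, map_sum, map_zsmul, hF, hf, map_inv]
    refine congrArg _ (Finset.sum_congr rfl fun j _ => congrArg _ (congrArg (single · _) ?_))
    funext i
    simp only [Fin.contractNth]
    split_ifs <;> simp
  obtain ⟨t⟩ := ChainComplex.nonempty_homology_addEquiv (groupHomology.inhomogeneousChains A)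
    (inhomogeneousChainsD G M) F (fun n x => by
      rw [groupHomology.inhomogeneousChains.d_def]
      exact DFunLike.congr_fun (h n) x) n
  exact ⟨t⟩

/-- A `G`-module as a representation of a copy of `G` in the universe of the module. -/
noncomputable def uliftRep (G : Type) (M : Type u) [Group G] [AddCommGroup M]
    [DistribMulAction G M] : Rep.{u} (ULift.{u} ℤ) (ULift.{u} G) :=
  Rep.of (X := M)
    { toFun g :=
        { toFun m := g.down • m
          map_add' := smul_add _
          map_smul' r m := map_zsmul (DistribSMul.toAddMonoidHom M g.down) r.down m }
      map_one' := LinearMap.ext fun m => one_smul G m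
      map_mul' g h := LinearMap.ext fun m => mul_smul g.down h.down m }

theorem nonempty_groupHomology_uliftRep_addEquiv (G : Type) (M : Type u) [Group G] [AddCommGroup M]
    [DistribMulAction G M] (n : ℕ) :
    Nonempty (groupHomology (uliftRep G M) (n + 1) ≃+ GroupHomology G M (n + 1)) :=
  nonempty_groupHomology_addEquiv (uliftRep G M) MulEquiv.ulift (AddEquiv.refl M)
    (fun _ _ => rfl) n

end Universes

section Dihedral

open DihedralGroup

universe u

/-- Two reflections generating the infinite dihedral group. -/
def dihedralInvolution (i : ULift.{u} Bool) : ULift.{u} (DihedralGroup 0) :=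
  ⟨cond i.down (sr (-1)) (sr 0)⟩

theorem dihedralInvolution_mul_self (i : ULift.{u} Bool) :
    dihedralInvolution i * dihedralInvolution i = 1 := by
  refine ULift.down_injective ?_
  obtain ⟨_ | _⟩ := i <;> simp [dihedralInvolution]

theorem dihedralInvolution_ne_one (i : ULift.{u} Bool) : dihedralInvolution i ≠ 1 := by
  intro h
  have := congrArg ULift.down h
  obtain ⟨_ | _⟩ := i <;> exact nomatch this

theorem not_isOfFinOrder_dihedralInvolution_mul (i j : ULift.{u} Bool) (hij : i ≠ j) :
    ¬ IsOfFinOrder (dihedralInvolution i * dihedralInvolution j) := by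
  have hr : ∀ z : ℤ, z ≠ 0 → ¬ IsOfFinOrder (⟨r z⟩ : ULift.{u} (DihedralGroup 0)) := by
    intro z hz h
    obtain ⟨n, hn, h⟩ := isOfFinOrder_iff_pow_eq_one.1 h
    have h2 : (r z : DihedralGroup 0) ^ n = r 0 := congrArg ULift.down h
    have h3 : z * (n : ℤ) = 0 := r.inj ((r_pow _ _).symm.trans h2)
    exact mul_ne_zero hz (Int.natCast_ne_zero.2 hn.ne') h3
  obtain ⟨_ | _⟩ := i <;> obtain ⟨_ | _⟩ := j
  · exact absurd rfl hij
  · exact hr (-1) (by simp)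
  · exact hr 1 one_ne_zero
  · exact absurd rfl hij

theorem dihedralInvolution_indep {k : Type*} [CommRing k]
    (x : ULift.{u} Bool → MonoidAlgebra k (ULift.{u} (DihedralGroup 0)))
    (hx : ∑ i, x i * (MonoidAlgebra.single (dihedralInvolution i) 1 - 1) = 0) (i : ULift.{u} Bool) :
    x i * (MonoidAlgebra.single (dihedralInvolution i) 1 - 1) = 0 := by
  rw [← Equiv.ulift.symm.sum_comp, Fintype.sum_bool] at hx
  obtain ⟨_ | _⟩ := i
  · rw [add_comm] at hx
    exact MonoidAlgebra.mul_involution_sub_one_eq_zero (dihedralInvolution_mul_self _)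
      (dihedralInvolution_mul_self _) (not_isOfFinOrder_dihedralInvolution_mul _ _ (by simp)) hx
  · exact MonoidAlgebra.mul_involution_sub_one_eq_zero (dihedralInvolution_mul_self _)
      (dihedralInvolution_mul_self _) (not_isOfFinOrder_dihedralInvolution_mul _ _ (by simp)) hx

theorem closure_range_dihedralInvolution :
    Subgroup.closure (Set.range dihedralInvolution.{u}) = ⊤ := by
  set H := Subgroup.closure (Set.range dihedralInvolution.{u}) with hH
  have h0 : (⟨sr 0⟩ : ULift.{u} (DihedralGroup 0)) ∈ H := Subgroup.subset_closure ⟨⟨false⟩, rfl⟩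
  have h1 : (⟨sr (-1)⟩ : ULift.{u} (DihedralGroup 0)) ∈ H := Subgroup.subset_closure ⟨⟨true⟩, rfl⟩
  have hr1 : (⟨r 1⟩ : ULift.{u} (DihedralGroup 0)) ∈ H := by
    have := H.mul_mem h1 h0
    have h : (⟨sr (-1)⟩ * ⟨sr 0⟩ : ULift.{u} (DihedralGroup 0)) = ⟨r 1⟩ :=
      ULift.down_injective (by simp)
    rwa [h] at this
  have hr : ∀ i : ℤ, (⟨r i⟩ : ULift.{u} (DihedralGroup 0)) ∈ H := fun i => by
    have := H.zpow_mem hr1 i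
    have h : ((⟨r 1⟩ : ULift.{u} (DihedralGroup 0)) ^ i) = ⟨r i⟩ :=
      ULift.down_injective ((r_one_zpow i).trans (congrArg r Int.cast_id))
    rwa [h] at this
  refine (Subgroup.eq_top_iff' _).2 ?_
  rintro ⟨i | i⟩
  · exact hr i
  · have := H.mul_mem h0 (hr i)
    have h : (⟨sr 0⟩ * ⟨r i⟩ : ULift.{u} (DihedralGroup 0)) = ⟨sr i⟩ :=
      ULift.down_injective (by simp)
    rwa [h] at this

end Dihedral

section DihedralHomology

open Finsupp

universe u

variable (M : Type u) [AddCommGroup M] [DistribMulAction (DihedralGroup 0) M]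

/-- The differentials `involutionCoeffD` for a module over the infinite dihedral group. -/
noncomputable def dihedralD (n : ℕ) :
    (involutionIndex (ULift.{u} Bool) (n + 1) →₀ M) →+ (involutionIndex (ULift.{u} Bool) n →₀ M) :=
  (involutionCoeffD dihedralInvolution.{u} (uliftRep (DihedralGroup 0) M) n).toAddMonoidHom

theorem nonempty_groupHomology_dihedral (n : ℕ) :
    Nonempty (GroupHomology (DihedralGroup 0) M (n + 1) ≃+
      (dihedralD M n).ker ⧸ (dihedralD M (n + 1)).range.addSubgroupOf (dihedralD M n).ker) := by
  classical
  obtain ⟨e⟩ := nonempty_groupHomology_uliftRep_addEquiv (DihedralGroup 0) M n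
  obtain ⟨f⟩ := nonempty_groupHomology_addEquiv_involution (uliftRep (DihedralGroup 0) M)
    dihedralInvolution_mul_self dihedralInvolution_ne_one closure_range_dihedralInvolution
    dihedralInvolution_indep n
  exact ⟨e.symm.trans f⟩

variable {M}

theorem dihedralInvolution_smul (i : ULift.{u} Bool) (m : M) :
    (uliftRep (DihedralGroup 0) M).ρ (dihedralInvolution i)⁻¹ m =
      (dihedralInvolution i).down • m := by
  rw [inv_eq_of_mul_eq_one_left (dihedralInvolution_mul_self i)]
  rfl

theorem dihedralD_zero_apply (x : ULift.{u} Bool →₀ M) :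
    dihedralD M 0 x = single PUnit.unit (∑ i, ((dihedralInvolution i).down • x i - x i)) := by
  refine (involutionCoeffD_zero_apply _ (uliftRep (DihedralGroup 0) M) x).trans
    (congrArg _ (Finset.sum_congr rfl fun i _ => ?_))
  rw [← dihedralInvolution_smul]
  rfl

theorem dihedralD_succ_apply (n : ℕ) (x : ULift.{u} Bool →₀ M) (i : ULift.{u} Bool) :
    (dihedralD M (n + 1) x : ULift.{u} Bool →₀ M) i =
      (dihedralInvolution i).down • x i + (-1 : ℤ) ^ n • x i := by
  refine (involutionCoeffD_succ_apply _ (uliftRep (DihedralGroup 0) M) n x i).trans ?_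
  rw [← dihedralInvolution_smul]
  rfl

end DihedralHomology

section DihedralQuotients

open Finsupp DihedralGroup

universe u

variable {M : Type u} [AddCommGroup M] [DistribMulAction (DihedralGroup 0) M]

theorem QuotientAddGroup.nonempty_addEquiv_of_surjective {K L : Type*} [AddCommGroup K]
    [AddCommGroup L] (N : AddSubgroup K) (Ψ : K →+ L) (hΨ : Function.Surjective Ψ)
    (hker : ∀ x, Ψ x = 0 ↔ x ∈ N) : Nonempty (K ⧸ N ≃+ L) := by
  obtain rfl : Ψ.ker = N := AddSubgroup.ext hker
  exact ⟨QuotientAddGroup.quotientKerEquivOfSurjective Ψ hΨ⟩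

theorem groupHomology_dihedral_even_eq_zero
    (h : ∀ (i : ULift.{u} Bool) (m : M), (dihedralInvolution i).down • m = -m →
      ∃ y, m = (dihedralInvolution i).down • y - y) (n : ℕ)
    (x : GroupHomology (DihedralGroup 0) M (2 * n + 2)) : x = 0 := by
  obtain ⟨e⟩ := nonempty_groupHomology_dihedral M (2 * n + 1)
  refine e.injective ?_
  rw [map_zero]
  obtain ⟨⟨z, hz⟩, hzx⟩ := QuotientAddGroup.mk_surjective (e x)
  rw [← hzx, QuotientAddGroup.eq_zero_iff, AddSubgroup.mem_addSubgroupOf]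
  change ULift.{u} Bool →₀ M at z
  have h1 : ∀ i, ∃ y, z i = (dihedralInvolution i).down • y - y := fun i => by
    refine h i _ (eq_neg_of_add_eq_zero_left ?_)
    have := (dihedralD_succ_apply (2 * n) z i).symm.trans (DFunLike.congr_fun hz i)
    rwa [Even.neg_one_pow (even_two_mul n), one_smul] at this
  choose y hy using h1
  refine ⟨equivFunOnFinite.symm y, Finsupp.ext fun i => ?_⟩
  refine (dihedralD_succ_apply (2 * n + 1) _ i).trans ?_
  rw [Odd.neg_one_pow (odd_two_mul_add_one n), neg_smul, one_smul, ← sub_eq_add_neg]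
  exact (hy i).symm

theorem mem_ker_dihedralD_even_iff
    (hinv : ∀ x : ULift.{u} Bool → M, ∑ i, ((dihedralInvolution i).down • x i - x i) = 0 →
      ∀ i, (dihedralInvolution i).down • x i = x i) (n : ℕ) (x : ULift.{u} Bool →₀ M) :
    dihedralD M (2 * n) x = 0 ↔ ∀ i, (dihedralInvolution i).down • x i = x i := by
  cases n with
  | zero =>
    refine (Iff.of_eq (congrArg (· = 0) (dihedralD_zero_apply x))).trans ?_
    rw [single_eq_zero]
    refine ⟨hinv x, fun h => Finset.sum_eq_zero fun i _ => ?_⟩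
    rw [h, sub_self]
  | succ n =>
    have : ∀ i, (dihedralD M (2 * n + 1 + 1) x : ULift.{u} Bool →₀ M) i =
        (dihedralInvolution i).down • x i - x i := fun i => by
      rw [dihedralD_succ_apply, Odd.neg_one_pow (odd_two_mul_add_one n), neg_smul, one_smul,
        ← sub_eq_add_neg]
    refine Finsupp.ext_iff.trans (forall_congr' fun i => ?_)
    refine (Iff.of_eq (congrArg (· = 0) (this i))).trans sub_eq_zero

theorem nonempty_groupHomology_dihedral_odd_addEquiv {L : Type*} [AddCommGroup L]
    (hinv : ∀ x : ULift.{u} Bool → M, ∑ i, ((dihedralInvolution i).down • x i - x i) = 0 →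
      ∀ i, (dihedralInvolution i).down • x i = x i)
    {F : AddSubgroup (ULift.{u} Bool → M)}
    (hF : ∀ x, x ∈ F ↔ ∀ i, (dihedralInvolution i).down • x i = x i)
    (Φ : F →+ L) (hΦ : Function.Surjective Φ)
    (hker : ∀ x : F, Φ x = 0 ↔ ∀ i, ∃ y, x.1 i = (dihedralInvolution i).down • y + y) (n : ℕ) :
    Nonempty (GroupHomology (DihedralGroup 0) M (2 * n + 1) ≃+ L) := by
  obtain ⟨e⟩ := nonempty_groupHomology_dihedral M (2 * n)
  let f : (dihedralD M (2 * n)).ker →+ F :=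
    { toFun z := ⟨(z.1 : ULift.{u} Bool →₀ M),
        (hF _).2 ((mem_ker_dihedralD_even_iff hinv n z.1).1 z.2)⟩
      map_zero' := rfl
      map_add' _ _ := rfl }
  have hf : Function.Surjective f := fun x =>
    ⟨⟨equivFunOnFinite.symm x.1, (mem_ker_dihedralD_even_iff hinv n _).2 ((hF _).1 x.2)⟩, rfl⟩
  obtain ⟨q⟩ := QuotientAddGroup.nonempty_addEquiv_of_surjective
    ((dihedralD M (2 * n + 1)).range.addSubgroupOf (dihedralD M (2 * n)).ker) (Φ.comp f)
    (hΦ.comp hf) fun z => by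
      refine (hker (f z)).trans ⟨fun h => ?_, ?_⟩
      · choose y hy using h
        refine ⟨equivFunOnFinite.symm y, Finsupp.ext fun i => ?_⟩
        refine (dihedralD_succ_apply (2 * n) _ i).trans ?_
        rw [Even.neg_one_pow (even_two_mul n), one_smul]
        exact (hy i).symm
      · rintro ⟨y, hy⟩ i
        change ULift.{u} Bool →₀ M at y
        refine ⟨y i, (DFunLike.congr_fun hy i).symm.trans
          ((dihedralD_succ_apply (2 * n) y i).trans ?_)⟩
        rw [Even.neg_one_pow (even_two_mul n), one_smul]
  exact ⟨e.trans q⟩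

theorem nonempty_groupHomology_dihedral_zero_addEquiv {L : Type*} [AddCommGroup L]
    (Φ : M →+ L) (hΦ : Function.Surjective Φ)
    (hker : ∀ m, Φ m = 0 ↔ ∃ y z : M,
      m = ((sr 0 : DihedralGroup 0) • y - y) + ((sr (-1) : DihedralGroup 0) • z - z)) :
    Nonempty (GroupHomology (DihedralGroup 0) M 0 ≃+ L) := by
  obtain ⟨o, ho⟩ : ∃ o : Fin 0 → DihedralGroup 0, ∀ g, g = o :=
    ⟨Fin.elim0, fun _ => Subsingleton.elim _ _⟩
  let ev : ((Fin 0 → DihedralGroup 0) →₀ M) →+ M := Finsupp.applyAddHom o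
  have hd (g : Fin 1 → DihedralGroup 0) (m : M) :
      inhomogeneousChainsD (DihedralGroup 0) M 0 (single g m) =
        single o ((g 0)⁻¹ • m - m) := by
    rw [sub_eq_add_neg, single_add]
    simp only [inhomogeneousChainsD, liftAddHom_apply_single, AddMonoidHom.coe_mk, ZeroHom.coe_mk,
      ho (Fin.contractNth _ _ _), ho (fun i => g i.succ)]
    simp
  have hinv : ∀ (g : DihedralGroup 0) (m : M), Φ (g • m) = Φ m := by
    have h0 : ∀ m : M, Φ ((sr 0 : DihedralGroup 0) • m) = Φ m := fun m => by
      rw [← sub_eq_zero, ← map_sub, hker]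
      exact ⟨m, 0, by simp⟩
    have h1 : ∀ m : M, Φ ((sr (-1) : DihedralGroup 0) • m) = Φ m := fun m => by
      rw [← sub_eq_zero, ← map_sub, hker]
      exact ⟨0, m, by simp⟩
    let S : Subgroup (ULift.{u} (DihedralGroup 0)) :=
      { carrier := {g | ∀ m, Φ (g.down • m) = Φ m}
        one_mem' m := congrArg Φ (one_smul _ m)
        mul_mem' {a b} ha hb m := by
          rw [ULift.mul_down, mul_smul, ha, hb]
        inv_mem' {a} ha m := by
          rw [← ha, ULift.inv_down, smul_inv_smul] }
    have hS : Subgroup.closure (Set.range dihedralInvolution.{u}) ≤ S := by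
      rw [Subgroup.closure_le]
      rintro _ ⟨⟨_ | _⟩, rfl⟩
      exacts [h0, h1]
    rw [closure_range_dihedralInvolution] at hS
    exact fun g => hS (Subgroup.mem_top (⟨g⟩ : ULift.{u} (DihedralGroup 0)))
  refine QuotientAddGroup.nonempty_addEquiv_of_surjective _
    (Φ.comp (ev.comp (AddSubgroup.subtype _))) ?_ ?_
  · intro l
    obtain ⟨m, rfl⟩ := hΦ l
    exact ⟨⟨single o m, trivial⟩, by simp [ev]⟩
  · rintro ⟨x, hx⟩
    rw [AddSubgroup.mem_addSubgroupOf]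
    obtain ⟨m, rfl⟩ : ∃ m, x = single o m := ⟨x o, by
      exact Finsupp.ext fun a => by rw [ho a, single_eq_same]⟩
    change Φ (ev (single o m)) = 0 ↔ single o m ∈ _
    rw [show ev (single o m) = m from single_eq_same]
    constructor
    · rw [hker]
      rintro ⟨y, z, rfl⟩
      refine ⟨single (fun _ => sr 0) y + single (fun _ => sr (-1)) z, ?_⟩
      rw [map_add, hd, hd, single_add]
      simp
    · rintro ⟨y, hy⟩
      have : Φ.comp (ev.comp (inhomogeneousChainsD (DihedralGroup 0) M 0)) = 0 := by
        refine Finsupp.addHom_ext fun g a => ?_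
        change Φ (ev (inhomogeneousChainsD (DihedralGroup 0) M 0 (single g a))) = 0
        rw [hd, show ev (single o _) = _ from single_eq_same, map_sub, hinv, sub_self]
      have h2 := DFunLike.congr_fun this y
      change Φ (ev (inhomogeneousChainsD (DihedralGroup 0) M 0 y)) = 0 at h2
      rw [hy] at h2
      exact (congrArg Φ single_eq_same).symm.trans h2

end DihedralQuotients

section Involutions

/-- A pointwise function of an integer-valued continuous function and of the membership in a
clopen set is continuous. -/
theorem ContinuousMap.exists_eq_of_isClopen {V : Set X} (hV : IsClopen V) (f : C(X, ℤ))
    (F : ℤ → Prop → ℤ) : ∃ h : C(X, ℤ), ∀ x, h x = F (f x) (x ∈ V) := by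
  refine ⟨⟨fun x => F (f x) (LocallyConstant.charFn ℤ hV x = 1), ?_⟩, fun x => ?_⟩
  · exact (continuous_of_discreteTopology (f := fun p : ℤ × ℤ => F p.1 (p.2 = 1))).comp
      (f.continuous.prodMk (LocallyConstant.continuous _))
  · change F _ _ = _
    rw [LocallyConstant.charFn_eq_one]

variable [CompactSpace X] [T2Space X] [TotallyDisconnectedSpace X]

/-- A compact set without fixed points of an involution `τ` is covered by a clopen set `V` and its
image under `τ`, with `V` disjoint from its image. -/
theorem exists_isClopen_of_involution {τ : X ≃ₜ X} (hτ : ∀ x, τ (τ x) = x) {K : Set X}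
    (hK : IsCompact K) (hfix : ∀ x ∈ K, τ x ≠ x) :
    ∃ V : Set X, IsClopen V ∧ (∀ x ∈ V, τ x ∉ V) ∧ ∀ x ∈ K, x ∈ V ∨ τ x ∈ V := by
  refine hK.induction_on
    (p := fun K => ∃ V : Set X, IsClopen V ∧ (∀ x ∈ V, τ x ∉ V) ∧ ∀ x ∈ K, x ∈ V ∨ τ x ∈ V)
    ⟨∅, isClopen_empty, by simp, by simp⟩ ?_ ?_ ?_
  · rintro s t hst ⟨V, hV, h1, h2⟩
    exact ⟨V, hV, h1, fun x hx => h2 x (hst hx)⟩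
  · rintro s t ⟨V, hV, h1, h2⟩ ⟨W, hW, h3, h4⟩
    refine ⟨V ∪ (W \ (V ∪ τ ⁻¹' V)),
      hV.union (hW.diff (hV.union (hV.preimage τ.continuous))), fun x hx => ?_, fun x hx => ?_⟩
    · have := h1 x
      have := h3 x
      simp only [Set.mem_union, Set.mem_sdiff, Set.mem_preimage, hτ] at hx ⊢
      tauto
    · have := h2 x
      have := h4 x
      simp only [Set.mem_union, Set.mem_sdiff, Set.mem_preimage, hτ] at hx ⊢
      tauto
  · intro x hx
    obtain ⟨U, U', hU, hU', hxU, hxU', hd⟩ := t2_separation (hfix x hx)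
    obtain ⟨W, hW, hxW, hWU⟩ := compact_exists_isClopen_in_isOpen
      (hU'.inter (hU.preimage τ.continuous)) ⟨hxU', hxU⟩
    refine ⟨W, mem_nhdsWithin_of_mem_nhds (hW.isOpen.mem_nhds hxW), W, hW, fun y hy hτy => ?_,
      fun y hy => Or.inl hy⟩
    exact Set.disjoint_left.mp hd (hWU hy).2 (hWU hτy).1

/-- A function which is antisymmetric under an involution `τ` is of the form `h ∘ τ - h`. -/
theorem ContinuousMap.exists_eq_comp_sub {τ : X ≃ₜ X} (hτ : ∀ x, τ (τ x) = x) {f : C(X, ℤ)}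
    (hf : f.comp (τ : C(X, X)) = -f) : ∃ h : C(X, ℤ), f = h.comp (τ : C(X, X)) - h := by
  classical
  have hf' (x) : f (τ x) = -f x := DFunLike.congr_fun hf x
  obtain ⟨V, hV, h1, h2⟩ := exists_isClopen_of_involution hτ
    (K := f ⁻¹' {0}ᶜ) ((isClosed_discrete _).preimage f.continuous).isCompact (by
      intro x hx h
      have := hf' x
      rw [h] at this
      exact hx (by simp; omega))
  obtain ⟨h, hh⟩ := f.exists_eq_of_isClopen hV (fun n P => if P then -n else 0)
  refine ⟨h, ContinuousMap.ext fun x => ?_⟩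
  have h1x := h1 x
  have h2x := h2 x
  change f x = h (τ x) - h x
  rw [hh, hh, hf']
  by_cases h0 : f x = 0
  · simp [h0]
  · have : x ∈ f ⁻¹' {0}ᶜ := h0
    by_cases hx : x ∈ V
    · simp [hx, h1x hx]
    · simp [hx, (h2x this).resolve_left hx]

/-- A function which is symmetric under an involution `τ`, and even on the fixed points of `τ`, is
of the form `h ∘ τ + h`. -/
theorem ContinuousMap.exists_eq_comp_add {τ : X ≃ₜ X} (hτ : ∀ x, τ (τ x) = x) {f : C(X, ℤ)}
    (hf : f.comp (τ : C(X, X)) = f) (heven : ∀ x, τ x = x → Even (f x)) :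
    ∃ h : C(X, ℤ), f = h.comp (τ : C(X, X)) + h := by
  classical
  have hf' (x) : f (τ x) = f x := DFunLike.congr_fun hf x
  obtain ⟨V, hV, h1, h2⟩ := exists_isClopen_of_involution hτ
    (K := f ⁻¹' {n | ¬ Even n}) ((isClosed_discrete _).preimage f.continuous).isCompact
    (fun x hx h => hx (heven x h))
  obtain ⟨h, hh⟩ := f.exists_eq_of_isClopen hV
    (fun n P => if Even n then n / 2 else if P then n else 0)
  refine ⟨h, ContinuousMap.ext fun x => ?_⟩
  have h1x := h1 x
  have h2x := h2 x
  change f x = h (τ x) + h x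
  rw [hh, hh, hf']
  by_cases h0 : Even (f x)
  · simp only [h0, if_true]
    obtain ⟨k, hk⟩ := h0
    omega
  · have : x ∈ f ⁻¹' {n | ¬ Even n} := h0
    by_cases hx : x ∈ V
    · simp [h0, hx, h1x hx]
    · simp [h0, hx, (h2x this).resolve_left hx]

/-- A continuous function with values in `ℤ/2` on a closed subset is the indicator function of a
clopen set. -/
theorem LocallyConstant.exists_isClopen_mem_iff {S : Set X} (hS : IsClosed S)
    (c : LocallyConstant S (ZMod 2)) :
    ∃ W : Set X, IsClopen W ∧ ∀ x : S, x.1 ∈ W ↔ c x = 1 := by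
  have hcl (a : ZMod 2) : IsClosed (Subtype.val '' (c ⁻¹' {a})) :=
    hS.isClosedEmbedding_subtypeVal.isClosedMap _ (c.isLocallyConstant.isClosed_fiber a)
  obtain ⟨W, hW, h1, h2⟩ := exists_clopen_of_closed_subset_open (hcl 1) (hcl 0).isOpen_compl (by
    rintro _ ⟨x, hx, rfl⟩ ⟨y, hy, hxy⟩
    obtain rfl := Subtype.ext hxy
    exact one_ne_zero (hx.symm.trans hy))
  refine ⟨W, hW, fun x => ⟨fun hx => ?_, fun hx => h1 ⟨x, hx, rfl⟩⟩⟩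
  have h0 : c x ≠ 0 := fun h => h2 hx ⟨x, h, rfl⟩
  generalize c x = a at h0
  decide +revert

end Involutions

section DihedralSystems

variable {φ σ : X ≃ₜ X}

/-- The involution `σ` of a dihedral system conjugates `φ ^ n` to `φ ^ (-n)`. -/
theorem zpow_apply_involution (hσ : ∀ x, σ (σ x) = x) (hrel : ∀ x, σ (φ (σ x)) = φ.symm x)
    (n : ℤ) (x : X) : (φ.toEquiv ^ n) (σ x) = σ ((φ.toEquiv ^ (-n)) x) := by
  have hss : σ.toEquiv⁻¹ = σ.toEquiv := by
    rw [inv_eq_iff_mul_eq_one]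
    exact Equiv.ext hσ
  have h1 : σ.toEquiv * φ.toEquiv * σ.toEquiv⁻¹ = φ.toEquiv⁻¹ := by
    rw [hss]
    exact Equiv.ext hrel
  have h2 : σ.toEquiv * φ.toEquiv ^ n * σ.toEquiv⁻¹ = φ.toEquiv ^ (-n) := by
    rw [← conj_zpow, h1, inv_zpow']
  have h3 : φ.toEquiv ^ n * σ.toEquiv = σ.toEquiv * φ.toEquiv ^ (-n) := by
    rw [← h2, hss, ← mul_assoc, ← mul_assoc, show σ.toEquiv * σ.toEquiv = 1 from Equiv.ext hσ,
      one_mul]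
  exact DFunLike.congr_fun h3 x

/-- In an infinite space, a point of a minimal dihedral system is not periodic. -/
theorem zpow_apply_ne_self [T1Space X] [Infinite X]
    (hσ : ∀ x, σ (σ x) = x) (hrel : ∀ x, σ (φ (σ x)) = φ.symm x) {x : X}
    (hmin : Dense {y : X | ∃ (n : ℤ) (i : Bool), y = (φ.toEquiv ^ n) (cond i (σ x) x)})
    {n : ℤ} (hn : n ≠ 0) : (φ.toEquiv ^ n) x ≠ x := by
  intro hx
  have hper (i : Bool) : (φ.toEquiv ^ n) (cond i (σ x) x) = cond i (σ x) x := by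
    cases i
    · exact hx
    · change (φ.toEquiv ^ n) (σ x) = σ x
      rw [zpow_apply_involution hσ hrel, zpow_neg, Equiv.Perm.inv_eq_iff_eq.mpr hx.symm]
  have hfin : {y : X | ∃ (n : ℤ) (i : Bool), y = (φ.toEquiv ^ n) (cond i (σ x) x)}.Finite := by
    refine (((Set.finite_Ico (0 : ℤ) |n|).prod (Set.finite_univ (α := Bool))).image
      (fun p => (φ.toEquiv ^ p.1) (cond p.2 (σ x) x))).subset ?_
    rintro _ ⟨k, i, rfl⟩
    refine ⟨(k % n, i), ⟨⟨Int.emod_nonneg k hn, Int.emod_lt_abs k hn⟩, trivial⟩, ?_⟩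
    conv_rhs => rw [← Int.emod_add_mul_ediv k n, zpow_add, zpow_mul]
    rw [Equiv.Perm.mul_apply, Equiv.Perm.zpow_apply_eq_self_of_apply_eq_self (hper i)]
  have huniv := hfin.isClosed.closure_eq.symm.trans hmin.closure_eq
  rw [huniv] at hfin
  exact Set.infinite_univ hfin

/-- In a minimal dihedral system on an infinite space which is not free, one of the two generating
involutions has a fixed point. -/
theorem exists_fixedPoint_of_not_free [T1Space X] [Infinite X]
    (hσ : ∀ x, σ (σ x) = x) (hrel : ∀ x, σ (φ (σ x)) = φ.symm x)
    (hmin : ∀ x : X,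
      Dense {y : X | ∃ (n : ℤ) (i : Bool), y = (φ.toEquiv ^ n) (cond i (σ x) x)})
    (hnotfree : ∃ (n : ℤ) (i : Bool) (x : X),
      (φ.toEquiv ^ n) (cond i (σ x) x) = x ∧ ¬(n = 0 ∧ i = false)) :
    ∃ x, σ x = x ∨ φ (σ x) = x := by
  obtain ⟨n, _ | _, x, hx, hn⟩ := hnotfree
  · exact absurd hx (zpow_apply_ne_self hσ hrel (hmin x) (fun h => hn ⟨h, rfl⟩))
  · change (φ.toEquiv ^ n) (σ x) = x at hx
    obtain ⟨k, rfl | rfl⟩ := n.even_or_odd'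
    · refine ⟨(φ.toEquiv ^ (-k)) x, Or.inl ?_⟩
      have h := congrArg (φ.toEquiv ^ (-k)) hx
      rw [← Equiv.Perm.mul_apply, ← zpow_add, zpow_apply_involution hσ hrel] at h
      rw [zpow_apply_involution hσ hrel] at hx
      have := zpow_apply_involution hσ hrel k x
      rw [← this, ← h, ← zpow_apply_involution hσ hrel]
      congr 2
      ring
    · refine ⟨(φ.toEquiv ^ (-k)) x, Or.inr ?_⟩
      have h := congrArg (φ.toEquiv ^ (-k)) hx
      rw [← Equiv.Perm.mul_apply, ← zpow_add] at h
      rw [← zpow_apply_involution hσ hrel, ← h]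
      change (φ.toEquiv * φ.toEquiv ^ k) (σ x) = _
      rw [← zpow_one_add]
      congr 2
      ring

/-- The two generating involutions of a minimal dihedral system have no common fixed point. -/
theorem disjoint_fixedPoints [T1Space X] [Infinite X]
    (hσ : ∀ x, σ (σ x) = x) (hrel : ∀ x, σ (φ (σ x)) = φ.symm x)
    (hmin : ∀ x : X,
      Dense {y : X | ∃ (n : ℤ) (i : Bool), y = (φ.toEquiv ^ n) (cond i (σ x) x)}) :
    Disjoint {x : X | σ x = x} {x : X | φ (σ x) = x} := by
  rw [Set.disjoint_left]
  intro x (h1 : σ x = x) (h2 : φ (σ x) = x)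
  rw [h1] at h2
  exact zpow_apply_ne_self hσ hrel (hmin x) one_ne_zero (by rw [zpow_one]; exact h2)

/-- In a minimal dihedral system, a continuous function invariant under both generating involutions
is constant. -/
theorem ContinuousMap.eq_const_of_invariant [Nonempty X]
    (hmin : ∀ x : X,
      Dense {y : X | ∃ (n : ℤ) (i : Bool), y = (φ.toEquiv ^ n) (cond i (σ x) x)})
    {f : C(X, ℤ)} (h0 : ∀ x, f (σ x) = f x) (h1 : ∀ x, f (φ x) = f x) :
    ∃ c : ℤ, ∀ x, f x = c := by
  obtain ⟨x⟩ := ‹Nonempty X›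
  have hnat (n : ℕ) (y : X) : f ((φ.toEquiv ^ n) y) = f y := by
    induction n with
    | zero => rfl
    | succ n ih =>
      rw [pow_succ', Equiv.Perm.mul_apply]
      exact (h1 _).trans ih
  have hint (n : ℤ) (y : X) : f ((φ.toEquiv ^ n) y) = f y := by
    obtain ⟨n, rfl | rfl⟩ := n.eq_nat_or_neg
    · rw [zpow_natCast, hnat]
    · conv_rhs => rw [← (φ.toEquiv ^ (n : ℤ)).apply_symm_apply y, zpow_natCast, hnat]
      rw [zpow_neg]
      rfl
  refine ⟨f x, fun y => ?_⟩
  have hcl : IsClosed {y | f y = f x} := isClosed_eq f.continuous continuous_const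
  refine hcl.closure_subset_iff.mpr ?_ (hmin x y)
  rintro _ ⟨n, _ | _, rfl⟩
  · exact hint n x
  · exact (hint n _).trans (h0 x)

end DihedralSystems

section FixedPoints

/-- Restriction of a pair of integer-valued functions to two disjoint closed subsets, modulo 2. -/
theorem exists_addMonoidHom_locallyConstant_union [CompactSpace X] [T2Space X]
    [TotallyDisconnectedSpace X] {A B : Set X} (hA : IsClosed A) (hB : IsClosed B)
    (hAB : Disjoint A B) :
    ∃ Φ : C(X, ℤ) × C(X, ℤ) →+ LocallyConstant (A ∪ B : Set X) (ZMod 2),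
      (∀ f p, (h : p ∈ A) → Φ f ⟨p, Or.inl h⟩ = (f.1 p : ZMod 2)) ∧
      (∀ f p, (h : p ∈ B) → Φ f ⟨p, Or.inr h⟩ = (f.2 p : ZMod 2)) := by
  classical
  obtain ⟨W, hW, hAW, hWB⟩ := exists_clopen_of_closed_subset_open hA hB.isOpen_compl
    hAB.subset_compl_right
  obtain ⟨w, hw⟩ := (0 : C(X, ℤ)).exists_eq_of_isClopen hW
    (fun _ P => if P then 1 else 0)
  refine ⟨AddMonoidHom.mk' (fun f => ⟨fun p => ((w p * f.1 p + (1 - w p) * f.2 p : ℤ) : ZMod 2),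
    (IsLocallyConstant.iff_continuous _).mpr ?_⟩) ?_, fun f p h => ?_, fun f p h => ?_⟩
  · exact (continuous_of_discreteTopology (f := fun n : ℤ => (n : ZMod 2))).comp
      ((w * f.1 + (1 - w) * f.2).continuous.comp continuous_subtype_val)
  · intro f g
    ext p
    simp only [Prod.fst_add, Prod.snd_add, ContinuousMap.add_apply, LocallyConstant.coe_add,
      LocallyConstant.coe_mk, Pi.add_apply]
    push_cast
    ring
  · have : w p = 1 := by rw [hw, if_pos (hAW h)]
    change ((w p * f.1 p + (1 - w p) * f.2 p : ℤ) : ZMod 2) = _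
    simp [this]
  · have : w p = 0 := by rw [hw, if_neg fun hp => hWB hp h]
    change ((w p * f.1 p + (1 - w p) * f.2 p : ℤ) : ZMod 2) = _
    simp [this]

variable {σ τ : X ≃ₜ X}

/-- A symmetric function which vanishes modulo 2 on the fixed points of an involution is of the
form `h ∘ τ + h`, and conversely. -/
theorem ContinuousMap.exists_eq_comp_add_iff [CompactSpace X] [T2Space X]
    [TotallyDisconnectedSpace X] (hτ : ∀ x, τ (τ x) = x) {f : C(X, ℤ)}
    (hf : f.comp (τ : C(X, X)) = f) :
    (∃ h : C(X, ℤ), f = h.comp (τ : C(X, X)) + h) ↔ ∀ x, τ x = x → (f x : ZMod 2) = 0 := by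
  refine ⟨?_, fun h => exists_eq_comp_add hτ hf fun x hx =>
    (ZMod.intCast_eq_zero_iff_even).mp (h x hx)⟩
  rintro ⟨h, rfl⟩ x hx
  rw [ZMod.intCast_eq_zero_iff_even]
  exact ⟨h x, congrArg (fun y => h y + h x) hx⟩

/-- Every function modulo 2 on a set of fixed points of an involution which is cut out by a clopen
set lifts to a symmetric integer-valued function. -/
theorem ContinuousMap.exists_invariant_of_isClopen (hτ : ∀ x, τ (τ x) = x) {W : Set X}
    (hW : IsClopen W) : ∃ f : C(X, ℤ), f.comp (τ : C(X, X)) = f ∧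
      ∀ x, τ x = x → (x ∈ W → f x = 1) ∧ (x ∉ W → f x = 0) := by
  classical
  obtain ⟨f, hf⟩ := (0 : C(X, ℤ)).exists_eq_of_isClopen (hW.inter (hW.preimage τ.continuous))
    (fun _ P => if P then 1 else 0)
  refine ⟨f, ContinuousMap.ext fun x => ?_, fun x hx => ?_⟩
  · change f (τ x) = f x
    rw [hf, hf]
    refine congrArg (fun P : Prop => if P then (1 : ℤ) else 0) (propext ?_)
    rw [Set.mem_inter_iff, Set.mem_inter_iff, Set.mem_preimage, Set.mem_preimage, hτ, and_comm]
  · rw [hf]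
    exact ⟨fun h => if_pos ⟨h, by rwa [Set.mem_preimage, hx]⟩, fun h => if_neg fun h' => h h'.1⟩

end FixedPoints

section CoinvariantsOfDihedral

variable {φ σ : X ≃ₜ X}

/-- The kernel of `f ↦ [f + f ∘ σ]`, when one of the two involutions has a fixed point. -/
theorem add_comp_mem_coboundariesSubgroup_iff [CompactSpace X] [T2Space X]
    [TotallyDisconnectedSpace X] [Nonempty X]
    (hσ : ∀ x, σ (σ x) = x) (hrel : ∀ x, σ (φ (σ x)) = φ.symm x)
    (hmin : ∀ x : X,
      Dense {y : X | ∃ (n : ℤ) (i : Bool), y = (φ.toEquiv ^ n) (cond i (σ x) x)})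
    (hfix : ∃ x, σ x = x ∨ φ (σ x) = x) (m : C(X, ℤ)) :
    m + m.comp (σ : C(X, X)) ∈ coboundariesSubgroup (φ : C(X, X)) ↔
      ∃ y z : C(X, ℤ), m = (y.comp (σ : C(X, X)) - y) +
        (z.comp (σ.trans φ : C(X, X)) - z) := by
  have hb (x : X) : φ (σ (φ (σ x))) = x := by rw [hrel, φ.apply_symm_apply]
  have hb' (x : X) : φ (σ (φ x)) = σ x := by
    have := hb (σ x)
    rwa [hσ] at this
  constructor
  · rintro ⟨h, hh⟩
    have e (x : X) : h x - h (φ x) = m x + m (σ x) := DFunLike.congr_fun hh x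
    have hu (x : X) : h (σ x) + h (φ x) = h x + h (φ (σ x)) := by
      have h1 := e x
      have h2 := e (σ x)
      rw [hσ] at h2
      omega
    obtain ⟨c, hc⟩ := ContinuousMap.eq_const_of_invariant hmin
      (f := h + h.comp (σ.trans φ : C(X, X))) (fun x => by
        change h (σ x) + h (φ (σ (σ x))) = h x + h (φ (σ x))
        rw [hσ, hu]) (fun x => by
        change h (φ x) + h (φ (σ (φ x))) = h x + h (φ (σ x))
        rw [hb', add_comm, hu])
    replace hc (x : X) : h x + h (φ (σ x)) = c := hc x
    have hc' (x : X) : h (σ x) + h (φ x) = c := (hu x).trans (hc x)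
    obtain ⟨d, hd⟩ : Even c := by
      obtain ⟨x, hx | hx⟩ := hfix
      · have h1 := e x
        have h2 := hc' x
        rw [hx] at h1 h2
        exact ⟨h x - m x, by omega⟩
      · have h1 := hc x
        rw [hx] at h1
        exact ⟨h x, h1.symm⟩
    obtain ⟨y, hy⟩ := ContinuousMap.exists_eq_comp_sub hσ (f := m - h + .const X d)
      (ContinuousMap.ext fun x => by
        change m (σ x) - h (σ x) + d = -(m x - h x + d)
        have h1 := e x
        have h2 := hc' x
        omega)
    obtain ⟨z, hz⟩ := ContinuousMap.exists_eq_comp_sub (τ := σ.trans φ) hb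
      (f := h - .const X d) (ContinuousMap.ext fun x => by
        change h (φ (σ x)) - d = -(h x - d)
        have h1 := hc x
        omega)
    exact ⟨y, z, by rw [← hy, ← hz]; abel⟩
  · rintro ⟨y, z, rfl⟩
    refine ⟨z.comp (σ.trans φ : C(X, X)) - z, ContinuousMap.ext fun x => ?_⟩
    change (z (φ (σ x)) - z x) - (z (φ (σ (φ x))) - z (φ x)) =
      ((y (σ x) - y x) + (z (φ (σ x)) - z x)) +
        ((y (σ (σ x)) - y (σ x)) + (z (φ (σ (σ x))) - z (σ x)))
    rw [hσ, hb']
    ring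

end CoinvariantsOfDihedral

/-- Homology of a non-free Cantor minimal `ℤ ⋊ ℤ₂`-system `α = (φ, σ)` (the infinite dihedral
group being `DihedralGroup 0`, with `r 1` acting by `φ` and `sr 0` by `σ`, so that in the
module `C(X, ℤ)` one has `r 1 • f = f ∘ φ⁻¹` and `sr 0 • f = f ∘ σ`):
`H₀ ≅ (1 + σ_*) H₀(ℤ, C(X, ℤ))`, `H_{2n-1} ≅ C(Fix_σ ⊔ Fix_{φσ}, ℤ/2)` (the fixed-point sets
being disjoint), and `H_{2n} = 0` for `n ≥ 1`. -/
theorem homology_of_not_free_dihedral_system {X : Type*} [TopologicalSpace X] [CompactSpace X]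
    [TopologicalSpace.MetrizableSpace X] [TotallyDisconnectedSpace X] [PerfectSpace X]
    [Nonempty X] (φ σ : X ≃ₜ X)
    (hσ : ∀ x, σ (σ x) = x) (hrel : ∀ x, σ (φ (σ x)) = φ.symm x)
    (hmin : ∀ x : X,
      Dense {y : X | ∃ (n : ℤ) (i : Bool), y = (φ.toEquiv ^ n) (cond i (σ x) x)})
    (hnotfree : ∃ (n : ℤ) (i : Bool) (x : X),
      (φ.toEquiv ^ n) (cond i (σ x) x) = x ∧ ¬(n = 0 ∧ i = false))
    [DistribMulAction (DihedralGroup 0) C(X, ℤ)]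
    (hr : ∀ f : C(X, ℤ),
      (DihedralGroup.r 1 : DihedralGroup 0) • f = f.comp (φ.symm : C(X, X)))
    (hsr : ∀ f : C(X, ℤ),
      (DihedralGroup.sr 0 : DihedralGroup 0) • f = f.comp (σ : C(X, X))) :
    Disjoint {x : X | σ x = x} {x : X | φ (σ x) = x} ∧
    Nonempty (GroupHomology (DihedralGroup 0) C(X, ℤ) 0 ≃+ onePlusSigmaStar φ σ) ∧
    (∀ n : ℕ, 1 ≤ n →
      Nonempty (GroupHomology (DihedralGroup 0) C(X, ℤ) (2 * n - 1) ≃+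
        LocallyConstant ({x : X | σ x = x} ∪ {x : X | φ (σ x) = x} : Set X) (ZMod 2))) ∧
    (∀ n : ℕ, 1 ≤ n → ∀ x : GroupHomology (DihedralGroup 0) C(X, ℤ) (2 * n), x = 0) := by
  have : Infinite X := by
    obtain ⟨x⟩ := ‹Nonempty X›
    exact Set.infinite_univ_iff.mp (infinite_of_mem_nhds x Filter.univ_mem)
  have hb (x : X) : φ (σ (φ (σ x))) = x := by rw [hrel, φ.apply_symm_apply]
  have hsrb (f : C(X, ℤ)) :
      (DihedralGroup.sr (-1) : DihedralGroup 0) • f = f.comp (σ.trans φ : C(X, X)) := by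
    rw [show (DihedralGroup.sr (-1) : DihedralGroup 0) = .r 1 * .sr 0 by
      rw [DihedralGroup.r_mul_sr, zero_sub], mul_smul, hsr, hr]
    refine ContinuousMap.ext fun x => congrArg f ?_
    change σ (φ.symm x) = φ (σ x)
    rw [← hrel, hσ]
  have hdisj := disjoint_fixedPoints hσ hrel hmin
  have hfix := exists_fixedPoint_of_not_free hσ hrel hmin hnotfree
  have hinv (x : Bool → C(X, ℤ)) (hx : ((x false).comp (σ : C(X, X)) - x false) +
      ((x true).comp (σ.trans φ : C(X, X)) - x true) = 0) :
      (x false).comp (σ : C(X, X)) = x false ∧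
        (x true).comp (σ.trans φ : C(X, X)) = x true := by
    have e (p : X) : (x false (σ p) - x false p) + (x true (φ (σ p)) - x true p) = 0 :=
      DFunLike.congr_fun hx p
    let u := (x false).comp (σ : C(X, X)) - x false
    have hu (p : X) : u p = x false (σ p) - x false p := rfl
    have huσ (p : X) : u (σ p) = -u p := by
      rw [hu, hu, hσ, neg_sub]
    have hub (p : X) : u (φ (σ p)) = -u p := by
      have h1 := e p
      have h2 := e (φ (σ p))
      rw [hb] at h2
      rw [hu, hu]
      omega
    obtain ⟨c, hc⟩ := ContinuousMap.eq_const_of_invariant hmin (f := u * u)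
      (fun p => by
        change u (σ p) * u (σ p) = u p * u p
        rw [huσ, neg_mul_neg])
      (fun p => by
        change u (φ p) * u (φ p) = u p * u p
        have h := hub (σ p)
        rw [hσ, huσ, neg_neg] at h
        rw [h])
    replace hc (p : X) : u p * u p = c := hc p
    obtain ⟨q, hq⟩ : ∃ q, u q = 0 := by
      obtain ⟨q, hq | hq⟩ := hfix
      · exact ⟨q, by rw [hu, hq, sub_self]⟩
      · have h := hub q
        rw [hq] at h
        exact ⟨q, by omega⟩
    have h0 (p : X) : u p = 0 := by
      rw [← mul_self_eq_zero, hc, ← hc q, hq, mul_zero]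
    refine ⟨ContinuousMap.ext fun p => sub_eq_zero.mp (h0 p), ContinuousMap.ext fun p => ?_⟩
    have h1 := e p
    rw [← hu, h0, zero_add] at h1
    exact sub_eq_zero.mp h1
  refine ⟨hdisj, ?_, ?_, ?_⟩
  · refine nonempty_groupHomology_dihedral_zero_addEquiv
      (((QuotientAddGroup.mk' (coboundariesSubgroup (φ : C(X, X)))).comp
        (AddMonoidHom.mk' (fun f : C(X, ℤ) => f + f.comp (σ : C(X, X)))
          (fun f g => by ext x; simp; ring))).codRestrict (onePlusSigmaStar φ σ)
        fun f => ⟨_, ⟨f, rfl⟩, rfl⟩) ?_ fun m => ?_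
    · rintro ⟨_, _, ⟨f, rfl⟩, rfl⟩
      exact ⟨f, rfl⟩
    · simp only [hsr, hsrb]
      rw [← add_comp_mem_coboundariesSubgroup_iff hσ hrel hmin hfix, ← QuotientAddGroup.eq_zero_iff,
        ← Subtype.coe_inj]
      rfl
  · rintro (_ | n) hn
    · omega
    obtain ⟨Ψ, hΨ0, hΨ1⟩ := exists_addMonoidHom_locallyConstant_union
      (isClosed_eq σ.continuous continuous_id) (isClosed_eq (φ.continuous.comp σ.continuous)
        continuous_id) hdisj
    let F : AddSubgroup (ULift Bool → C(X, ℤ)) :=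
      { carrier := {x | ∀ i, (dihedralInvolution i).down • x i = x i}
        zero_mem' i := smul_zero _
        add_mem' {x y} hx hy i := by rw [Pi.add_apply, smul_add, hx, hy]
        neg_mem' {x} hx i := by rw [Pi.neg_apply, smul_neg, hx] }
    have hF0 (x : F) : (x.1 ⟨false⟩).comp (σ : C(X, X)) = x.1 ⟨false⟩ :=
      (hsr _).symm.trans (x.2 ⟨false⟩)
    have hF1 (x : F) : (x.1 ⟨true⟩).comp (σ.trans φ : C(X, X)) = x.1 ⟨true⟩ :=
      (hsrb _).symm.trans (x.2 ⟨true⟩)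
    refine nonempty_groupHomology_dihedral_odd_addEquiv (fun x hx i => ?_) (F := F)
      (fun x => Iff.rfl)
      (Ψ.comp (((Pi.evalAddMonoidHom _ ⟨false⟩).prod (Pi.evalAddMonoidHom _ ⟨true⟩)).comp
        F.subtype)) (fun c => ?_) (fun x => ?_) n
    · rw [← Equiv.ulift.symm.sum_comp, Fintype.sum_bool, add_comm] at hx
      obtain ⟨h0, h1⟩ := hinv (fun i => x ⟨i⟩)
        ((congrArg₂ (fun a b => (a - x ⟨false⟩) + (b - x ⟨true⟩)) (hsr _) (hsrb _)).symm.trans hx)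
      obtain ⟨_ | _⟩ := i
      exacts [(hsr _).trans h0, (hsrb _).trans h1]
    · obtain ⟨W, hW, hWc⟩ := c.exists_isClopen_mem_iff
        ((isClosed_eq σ.continuous continuous_id).union
          (isClosed_eq (φ.continuous.comp σ.continuous) continuous_id))
      obtain ⟨f, hf, hf'⟩ := ContinuousMap.exists_invariant_of_isClopen hσ hW
      obtain ⟨g, hg, hg'⟩ := ContinuousMap.exists_invariant_of_isClopen (τ := σ.trans φ) hb hW
      have key (a : ZMod 2) (P : Prop) (k : ℤ) (hP : P ↔ a = 1) (h1 : P → k = 1)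
          (h0 : ¬P → k = 0) : (k : ZMod 2) = a := by
        by_cases h : P
        · rw [h1 h, hP.mp h, Int.cast_one]
        · rw [h0 h, Int.cast_zero]
          rw [hP] at h
          clear hP h0 h1
          decide +revert
      refine ⟨⟨fun i => cond i.down g f, ?_⟩, LocallyConstant.ext ?_⟩
      · rintro ⟨_ | _⟩
        exacts [(hsr f).trans hf, (hsrb g).trans hg]
      · rintro ⟨p, hp | hp⟩
        · exact (hΨ0 _ p hp).trans (key _ _ _ (hWc ⟨p, _⟩) (hf' p hp).1 (hf' p hp).2)
        · exact (hΨ1 _ p hp).trans (key _ _ _ (hWc ⟨p, _⟩) (hg' p hp).1 (hg' p hp).2)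
    · have h0 := ContinuousMap.exists_eq_comp_add_iff hσ (hF0 x)
      have h1 := ContinuousMap.exists_eq_comp_add_iff (τ := σ.trans φ) hb (hF1 x)
      simp only [← hsr] at h0
      simp only [← hsrb] at h1
      constructor
      · intro hx
        rintro ⟨_ | _⟩
        · exact h0.mpr fun p hp => (hΨ0 _ p hp).symm.trans (DFunLike.congr_fun hx _)
        · exact h1.mpr fun p hp => (hΨ1 _ p hp).symm.trans (DFunLike.congr_fun hx _)
      · intro hx
        refine LocallyConstant.ext ?_
        rintro ⟨p, hp | hp⟩
        · exact (hΨ0 _ p hp).trans (h0.mp (hx ⟨false⟩) p hp)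
        · exact (hΨ1 _ p hp).trans (h1.mp (hx ⟨true⟩) p hp)
  · rintro (_ | n) hn
    · omega
    refine groupHomology_dihedral_even_eq_zero (fun i m hm => ?_) n
    obtain ⟨_ | _⟩ := i
    · obtain ⟨y, hy⟩ := ContinuousMap.exists_eq_comp_sub hσ ((hsr m).symm.trans hm)
      exact ⟨y, hy.trans (congrArg (· - y) (hsr y).symm)⟩
    · obtain ⟨y, hy⟩ := ContinuousMap.exists_eq_comp_sub (τ := σ.trans φ) hb
        ((hsrb m).symm.trans hm)
      exact ⟨y, hy.trans (congrArg (· - y) (hsrb y).symm)⟩
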